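/- Explicit nearest free point for the R_y family: for every θ ∈ (0, π/2), let ρ_θ = |ψ_θ⟩⟨ψ_θ| with |ψ_θ⟩ = cos(θ/2)|00⟩ + sin(θ/2)|11⟩, and let σ* = sin θ·|+_L⟩⟨+_L| + (1 − sin θ)·|00⟩⟨00| with |+_L⟩ = (1/√2)(|00⟩ + |11⟩). Then σ* is a convex combination of pure two-qubit stabilizer states, ρ_θ − σ* = ((cos θ + sin θ − 1)/2)·(|00⟩⟨00| − |11⟩⟨11|), the Wigner ℓ¹ distance is ‖W_{ρ_θ} − W_{σ*}‖₁ = cos θ + sin θ − 1, and consequently C(ρ_θ) ≤ cos θ + sin θ − 1. -/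

import Mathlib

open Matrix Kronecker Finset
open scoped ComplexOrder

noncomputable section

def PX : Matrix (Fin 2) (Fin 2) ℂ := !![0, 1; 1, 0]
def PY : Matrix (Fin 2) (Fin 2) ℂ := !![0, -Complex.I; Complex.I, 0]
def PZ : Matrix (Fin 2) (Fin 2) ℂ := !![1, 0; 0, -1]

/-- The single-qubit phase-point operator `A_{(q,p)}`. -/
def A1 (a : ZMod 2 × ZMod 2) : Matrix (Fin 2) (Fin 2) ℂ :=
  (1 / 2 : ℂ) • ((1 : Matrix (Fin 2) (Fin 2) ℂ)
    + ((-1 : ℂ) ^ a.2.val) • PX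
    + ((-1 : ℂ) ^ (a.1.val + a.2.val)) • PY
    + ((-1 : ℂ) ^ a.1.val) • PZ)

def pauli : Fin 4 → Matrix (Fin 2) (Fin 2) ℂ := ![1, PX, PY, PZ]

/-- A density matrix: positive semidefinite with unit trace. -/
def IsDensity {d : ℕ} (ρ : Matrix (Fin d) (Fin d) ℂ) : Prop :=
  ρ.PosSemidef ∧ ρ.trace = 1

/-- Kronecker product of 2×2 matrices as a 4×4 matrix. -/
def kron2 (M N : Matrix (Fin 2) (Fin 2) ℂ) : Matrix (Fin 4) (Fin 4) ℂ :=
  Matrix.reindex (finProdFinEquiv.trans (finCongr (by norm_num)))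
    (finProdFinEquiv.trans (finCongr (by norm_num))) (M ⊗ₖ N)

/-- The two-qubit phase-point operator `A_α = A_{α₁} ⊗ A_{α₂}`. -/
def A2 (α : (ZMod 2 × ZMod 2) × (ZMod 2 × ZMod 2)) : Matrix (Fin 4) (Fin 4) ℂ :=
  kron2 (A1 α.1) (A1 α.2)

/-- The two-qubit Pauli group `P₂`. -/
def Pauli2 : Set (Matrix (Fin 4) (Fin 4) ℂ) :=
  { M | ∃ (k : Fin 4) (P Q : Fin 4), M = Complex.I ^ (k : ℕ) • kron2 (pauli P) (pauli Q) }

/-- `S` is an abelian subgroup of `P₂` with `|S| = 4` and `-I ∉ S`. -/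
def IsStabGroup2 (S : Finset (Matrix (Fin 4) (Fin 4) ℂ)) : Prop :=
  (∀ g ∈ S, g ∈ Pauli2) ∧ (1 : Matrix (Fin 4) (Fin 4) ℂ) ∈ S ∧
  (∀ g ∈ S, ∀ h ∈ S, g * h ∈ S ∧ g * h = h * g) ∧
  S.card = 4 ∧ (-1 : Matrix (Fin 4) (Fin 4) ℂ) ∉ S

/-- The pure two-qubit stabilizer states. -/
def Stab2 : Set (Matrix (Fin 4) (Fin 4) ℂ) :=
  { σ | ∃ S : Finset (Matrix (Fin 4) (Fin 4) ℂ),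
      IsStabGroup2 S ∧ σ = (4 : ℂ)⁻¹ • ∑ g ∈ S, g }

/-- Two-qubit discrete Wigner function (of any 4×4 matrix). -/
def W2 (ρ : Matrix (Fin 4) (Fin 4) ℂ) (α : (ZMod 2 × ZMod 2) × (ZMod 2 × ZMod 2)) : ℝ :=
  ((4 : ℂ)⁻¹ * (ρ * A2 α).trace).re

/-- Two-qubit free Wigner polytope. -/
def WFree2 : Set (((ZMod 2 × ZMod 2) × (ZMod 2 × ZMod 2)) → ℝ) :=
  convexHull ℝ { w | ∃ σ ∈ Stab2, w = W2 σ }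

/-- Two-qubit Wigner distance `C(ρ)`. -/
def C2 (ρ : Matrix (Fin 4) (Fin 4) ℂ) : ℝ :=
  sInf { d | ∃ f ∈ WFree2, d = ∑ α, |W2 ρ α - f α| }

/-- Two-qubit stabilizer extent `Γ(ρ)`. -/
def Gam2 (ρ : Matrix (Fin 4) (Fin 4) ℂ) : ℝ :=
  sInf { t | ∃ (k : ℕ) (a : Fin k → ℝ) (s : Fin k → Matrix (Fin 4) (Fin 4) ℂ),
      (∀ i, s i ∈ Stab2) ∧ ρ = ∑ i, a i • s i ∧ t = ∑ i, |a i| }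

/-- Rank-one projection `|ψ⟩⟨ψ|`. -/
def proj (ψ : Fin 4 → ℂ) : Matrix (Fin 4) (Fin 4) ℂ :=
  Matrix.vecMulVec ψ fun j => (starRingEnd ℂ) (ψ j)

/-- The basis vector `|00⟩`. -/
def e0 : Fin 4 → ℂ := fun i => if i = 0 then 1 else 0

/-- The basis vector `|11⟩`. -/
def e3 : Fin 4 → ℂ := fun i => if i = 3 then 1 else 0

/-- `|ψ_θ⟩ = cos(θ/2)|00⟩ + sin(θ/2)|11⟩` (the R_y family). -/
def psiRy (θ : ℝ) : Fin 4 → ℂ := fun i =>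
  if i = 0 then ((Real.cos (θ / 2) : ℝ) : ℂ)
  else if i = 3 then ((Real.sin (θ / 2) : ℝ) : ℂ) else 0

/-- `|ψ_θ⟩ = cos(θ/2)|00⟩ − i sin(θ/2)|11⟩` (the R_x family). -/
def psiRx (θ : ℝ) : Fin 4 → ℂ := fun i =>
  if i = 0 then ((Real.cos (θ / 2) : ℝ) : ℂ)
  else if i = 3 then -Complex.I * ((Real.sin (θ / 2) : ℝ) : ℂ) else 0

/-- `|Φ_θ⟩ = (1/√2)(|00⟩ + e^{iθ}|11⟩)` (the Bell+R_z family). -/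
def psiB (θ : ℝ) : Fin 4 → ℂ := fun i =>
  if i = 0 then (((Real.sqrt 2 : ℝ) : ℂ))⁻¹
  else if i = 3 then Complex.exp (θ * Complex.I) / ((Real.sqrt 2 : ℝ) : ℂ) else 0

/-- `|+_L⟩ = (1/√2)(|00⟩ + |11⟩)`. -/
def pPlus : Fin 4 → ℂ := fun i =>
  if i = 0 then (((Real.sqrt 2 : ℝ) : ℂ))⁻¹
  else if i = 3 then (((Real.sqrt 2 : ℝ) : ℂ))⁻¹ else 0

/-- `|−_L⟩ = (1/√2)(|00⟩ − |11⟩)`. -/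
def pMinus : Fin 4 → ℂ := fun i =>
  if i = 0 then (((Real.sqrt 2 : ℝ) : ℂ))⁻¹
  else if i = 3 then -(((Real.sqrt 2 : ℝ) : ℂ))⁻¹ else 0

theorem kron2_fin_two (a b c d e f g h : ℂ) :
    kron2 !![a, b; c, d] !![e, f; g, h] =
      !![a * e, a * f, b * e, b * f; a * g, a * h, b * g, b * h;
        c * e, c * f, d * e, d * f; c * g, c * h, d * g, d * h] := by
  ext i j
  fin_cases i <;> fin_cases j <;> rfl

theorem pauli_kron_mem_Pauli2 (P Q : Fin 4) : kron2 (pauli P) (pauli Q) ∈ Pauli2 :=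
  ⟨0, P, Q, by simp⟩

/-- Two commuting traceless Pauli involutions with traceless product generate a stabilizer
group, hence a stabilizer state. -/
theorem stab_mem_of_generators {a b : Matrix (Fin 4) (Fin 4) ℂ}
    (ha : a ∈ Pauli2) (hb : b ∈ Pauli2) (hab : a * b ∈ Pauli2)
    (haa : a * a = 1) (hbb : b * b = 1) (hcomm : b * a = a * b)
    (hta : a.trace = 0) (htb : b.trace = 0) (htab : (a * b).trace = 0) :
    (4 : ℂ)⁻¹ • (1 + a + b + a * b) ∈ Stab2 := by
  classical
  have ne_one : ∀ m : Matrix (Fin 4) (Fin 4) ℂ, m.trace = 0 → m ≠ 1 ∧ m ≠ -1 := by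
    refine fun m hm => ⟨?_, ?_⟩ <;> rintro rfl <;> simp at hm
  have h_one : (1 : Matrix (Fin 4) (Fin 4) ℂ) ≠ -1 := by
    intro h
    have := congrFun (congrFun h 0) 0
    norm_num [Matrix.one_apply] at this
  have hne_ab : a ≠ b := fun h => (ne_one _ htab).1 (by rw [← h, haa])
  have ha_abb : a * (a * b) = b := by rw [← mul_assoc, haa, one_mul]
  have hab_b : a * b * b = a := by rw [mul_assoc, hbb, mul_one]
  have hb_ab : b * (a * b) = a := by rw [← hcomm, ← mul_assoc, hbb, one_mul]
  have hab_a : a * b * a = b := by rw [mul_assoc, hcomm, ha_abb]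
  have hsq : a * b * (a * b) = 1 := by rw [← mul_assoc, hab_a, hbb]
  have hne_a : a ≠ a * b := fun h => (ne_one _ htb).1 (by rw [← ha_abb, ← h, haa])
  have hne_b : b ≠ a * b := fun h => (ne_one _ hta).1 (by rw [← hab_b, ← h, hbb])
  have hone_a := (ne_one _ hta).1.symm
  have hone_b := (ne_one _ htb).1.symm
  have hone_ab := (ne_one _ htab).1.symm
  refine ⟨{1, a, b, a * b}, ⟨?_, by simp, ?_, ?_, ?_⟩, ?_⟩
  · simp only [Finset.mem_insert, Finset.mem_singleton]
    rintro g (rfl | rfl | rfl | rfl)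
    · exact ⟨0, 0, 0, by simp [pauli, kron2]⟩
    all_goals assumption
  · simp only [Finset.mem_insert, Finset.mem_singleton]
    rintro g (rfl | rfl | rfl | rfl) h (rfl | rfl | rfl | rfl) <;>
      simp [haa, hbb, hcomm, ha_abb, hab_b, hb_ab, hab_a, hsq]
  · rw [Finset.card_insert_of_notMem (by simp [hone_a, hone_b, hone_ab]),
      Finset.card_insert_of_notMem (by simp [hne_ab, hne_a]),
      Finset.card_insert_of_notMem (by simpa using hne_b), Finset.card_singleton]
  · simp only [Finset.mem_insert, Finset.mem_singleton, not_or]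
    exact ⟨h_one.symm, (ne_one _ hta).2.symm, (ne_one _ htb).2.symm, (ne_one _ htab).2.symm⟩
  · rw [Finset.sum_insert (by simp [hone_a, hone_b, hone_ab]),
      Finset.sum_insert (by simp [hne_ab, hne_a]), Finset.sum_insert (by simpa using hne_b),
      Finset.sum_singleton, ← add_assoc, ← add_assoc]

theorem pauli_kron_ZI : kron2 (pauli 3) (pauli 0) = diagonal ![1, 1, -1, -1] := by
  simp [pauli, PZ, one_fin_two, kron2_fin_two]
  ext i j
  fin_cases i <;> fin_cases j <;> simp

theorem pauli_kron_IZ : kron2 (pauli 0) (pauli 3) = diagonal ![1, -1, 1, -1] := by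
  simp [pauli, PZ, one_fin_two, kron2_fin_two]
  ext i j
  fin_cases i <;> fin_cases j <;> simp

theorem pauli_kron_ZZ : kron2 (pauli 3) (pauli 3) = diagonal ![1, -1, -1, 1] := by
  simp [pauli, PZ, kron2_fin_two]
  ext i j
  fin_cases i <;> fin_cases j <;> simp

theorem pauli_kron_XX :
    kron2 (pauli 1) (pauli 1) = !![0, 0, 0, 1; 0, 0, 1, 0; 0, 1, 0, 0; 1, 0, 0, 0] := by
  simp [pauli, PX, kron2_fin_two]

theorem pauli_kron_YY :
    kron2 (pauli 2) (pauli 2) = !![0, 0, 0, -1; 0, 0, 1, 0; 0, 1, 0, 0; -1, 0, 0, 0] := by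
  simp [pauli, PY, kron2_fin_two]

theorem proj_e0_mem_Stab2 : proj e0 ∈ Stab2 := by
  have hmul : kron2 (pauli 3) (pauli 0) * kron2 (pauli 0) (pauli 3)
      = kron2 (pauli 3) (pauli 3) := by
    rw [pauli_kron_ZI, pauli_kron_IZ, pauli_kron_ZZ, diagonal_mul_diagonal]
    congr 1; ext i; fin_cases i <;> simp
  have hsum : proj e0 = (4 : ℂ)⁻¹ • (1 + kron2 (pauli 3) (pauli 0) + kron2 (pauli 0) (pauli 3)
      + kron2 (pauli 3) (pauli 0) * kron2 (pauli 0) (pauli 3)) := by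
    rw [hmul, pauli_kron_ZI, pauli_kron_IZ, pauli_kron_ZZ]
    ext i j
    fin_cases i <;> fin_cases j <;> norm_num [proj, e0, vecMulVec_apply]
  rw [hsum]
  refine stab_mem_of_generators (pauli_kron_mem_Pauli2 3 0) (pauli_kron_mem_Pauli2 0 3)
    (hmul ▸ pauli_kron_mem_Pauli2 3 3) ?_ ?_ ?_ ?_ ?_ ?_
  · rw [pauli_kron_ZI, diagonal_mul_diagonal, diagonal_eq_one]
    ext i; fin_cases i <;> simp
  · rw [pauli_kron_IZ, diagonal_mul_diagonal, diagonal_eq_one]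
    ext i; fin_cases i <;> simp
  · rw [pauli_kron_ZI, pauli_kron_IZ, diagonal_mul_diagonal, diagonal_mul_diagonal]
    congr 1; ext i; exact mul_comm _ _
  · simp [pauli_kron_ZI, Fin.sum_univ_four]
  · simp [pauli_kron_IZ, Fin.sum_univ_four]
  · simp [hmul, pauli_kron_ZZ, Fin.sum_univ_four]

theorem inv_sqrt_two_mul_self : ((√2 : ℝ) : ℂ)⁻¹ * ((√2 : ℝ) : ℂ)⁻¹ = 2⁻¹ := by
  rw [← mul_inv, ← Complex.ofReal_mul, Real.mul_self_sqrt zero_le_two, Complex.ofReal_ofNat]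

theorem proj_pPlus :
    proj pPlus = !![2⁻¹, 0, 0, 2⁻¹; 0, 0, 0, 0; 0, 0, 0, 0; 2⁻¹, 0, 0, 2⁻¹] := by
  ext i j
  fin_cases i <;> fin_cases j <;>
    simp [proj, pPlus, vecMulVec_apply, inv_sqrt_two_mul_self]

theorem proj_pPlus_mem_Stab2 : proj pPlus ∈ Stab2 := by
  have hZZ : kron2 (pauli 3) (pauli 3) =
      !![1, 0, 0, 0; 0, -1, 0, 0; 0, 0, -1, 0; 0, 0, 0, 1] := by
    simp [pauli, PZ, kron2_fin_two]
  have hmul : kron2 (pauli 1) (pauli 1) * kron2 (pauli 3) (pauli 3)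
      = -kron2 (pauli 2) (pauli 2) := by
    rw [pauli_kron_XX, hZZ, pauli_kron_YY]
    ext i j
    fin_cases i <;> fin_cases j <;> simp [mul_apply, Fin.sum_univ_four]
  have hsum : proj pPlus = (4 : ℂ)⁻¹ • (1 + kron2 (pauli 1) (pauli 1)
      + kron2 (pauli 3) (pauli 3) + kron2 (pauli 1) (pauli 1) * kron2 (pauli 3) (pauli 3)) := by
    rw [hmul, pauli_kron_XX, hZZ, pauli_kron_YY, proj_pPlus]
    ext i j
    fin_cases i <;> fin_cases j <;> norm_num
  rw [hsum]
  refine stab_mem_of_generators (pauli_kron_mem_Pauli2 1 1) (pauli_kron_mem_Pauli2 3 3)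
    ⟨2, 2, 2, by simp [hmul]⟩ ?_ ?_ ?_ ?_ ?_ ?_
  · rw [pauli_kron_XX]
    ext i j
    fin_cases i <;> fin_cases j <;> simp [mul_apply, Fin.sum_univ_four]
  · rw [hZZ]
    ext i j
    fin_cases i <;> fin_cases j <;> simp [mul_apply, Fin.sum_univ_four]
  · rw [pauli_kron_XX, hZZ]
    ext i j
    fin_cases i <;> fin_cases j <;> simp [mul_apply, Fin.sum_univ_four]
  · simp [pauli_kron_XX, trace, Fin.sum_univ_four]
  · simp [hZZ, trace, Fin.sum_univ_four]
  · simp [hmul, pauli_kron_YY, trace, Fin.sum_univ_four]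

theorem W2_add (M N : Matrix (Fin 4) (Fin 4) ℂ) : W2 (M + N) = W2 M + W2 N := by
  ext α
  simp only [W2, Pi.add_apply, add_mul, trace_add, mul_add, Complex.add_re]

theorem W2_smul (r : ℝ) (M : Matrix (Fin 4) (Fin 4) ℂ) : W2 (r • M) = r • W2 M := by
  ext α
  simp only [W2, Pi.smul_apply, smul_mul, trace_smul, mul_smul_comm, Complex.smul_re]

theorem W2_sub (M N : Matrix (Fin 4) (Fin 4) ℂ) : W2 (M - N) = W2 M - W2 N := by
  rw [eq_sub_iff_add_eq, ← W2_add, sub_add_cancel]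

theorem zmod_two_eq_zero_or_eq_one : ∀ q : ZMod 2, q = 0 ∨ q = 1 := by
  decide

theorem A1_zero_zero (a : ZMod 2 × ZMod 2) : A1 a 0 0 = if a.1 = 0 then 1 else 0 := by
  obtain ⟨q, p⟩ := a
  obtain rfl | rfl := zmod_two_eq_zero_or_eq_one q <;> norm_num [A1, PX, PY, PZ, ZMod.val_one]

theorem A1_one_one (a : ZMod 2 × ZMod 2) : A1 a 1 1 = if a.1 = 0 then 0 else 1 := by
  obtain ⟨q, p⟩ := a
  obtain rfl | rfl := zmod_two_eq_zero_or_eq_one q <;> norm_num [A1, PX, PY, PZ, ZMod.val_one]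

theorem trace_proj_e0_mul_kron2 (M N : Matrix (Fin 2) (Fin 2) ℂ) :
    (proj e0 * kron2 M N).trace = M 0 0 * N 0 0 := by
  rw [eta_fin_two M, eta_fin_two N, kron2_fin_two]
  simp [proj, e0, trace, mul_apply, vecMulVec_apply]

theorem trace_proj_e3_mul_kron2 (M N : Matrix (Fin 2) (Fin 2) ℂ) :
    (proj e3 * kron2 M N).trace = M 1 1 * N 1 1 := by
  rw [eta_fin_two M, eta_fin_two N, kron2_fin_two]
  simp [proj, e3, trace, mul_apply, vecMulVec_apply]

theorem sum_abs_W2_proj_e0_sub_proj_e3 : ∑ α, |W2 (proj e0 - proj e3) α| = 2 := by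
  have h : ∀ α, |W2 (proj e0 - proj e3) α| = if α.1.1 = α.2.1 then 4⁻¹ else 0 := by
    rintro ⟨⟨q₁, p₁⟩, ⟨q₂, p₂⟩⟩
    simp only [W2, A2, sub_mul, trace_sub, trace_proj_e0_mul_kron2, trace_proj_e3_mul_kron2,
      A1_zero_zero, A1_one_one]
    obtain rfl | rfl := zmod_two_eq_zero_or_eq_one q₁ <;>
      obtain rfl | rfl := zmod_two_eq_zero_or_eq_one q₂ <;> norm_num
  simp only [h, Fintype.sum_prod_type]
  norm_num [ZMod.card]

theorem proj_psiRy_sub (θ : ℝ) :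
    proj (psiRy θ) - (Real.sin θ • proj pPlus + (1 - Real.sin θ) • proj e0)
      = ((Real.cos θ + Real.sin θ - 1) / 2) • (proj e0 - proj e3) := by
  have hcc : Complex.cos (θ / 2) * Complex.cos (θ / 2) = (1 + Complex.cos θ) / 2 := by
    rw [← pow_two, Complex.cos_sq, mul_div_cancel₀ _ two_ne_zero]; ring
  have hss : Complex.sin (θ / 2) * Complex.sin (θ / 2) = (1 - Complex.cos θ) / 2 := by
    rw [← pow_two, Complex.sin_sq, pow_two, hcc]; ring
  have hcs : Complex.cos (θ / 2) * Complex.sin (θ / 2) = Complex.sin θ / 2 := by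
    have := Complex.sin_two_mul (θ / 2)
    rw [mul_div_cancel₀ _ two_ne_zero] at this
    rw [this]; ring
  have hsc : Complex.sin (θ / 2) * Complex.cos (θ / 2) = Complex.sin θ / 2 := by
    rw [mul_comm, hcs]
  rw [proj_pPlus]
  ext i j
  fin_cases i <;> fin_cases j <;>
    simp [proj, psiRy, e0, e3, vecMulVec_apply, ← Complex.cos_conj, ← Complex.sin_conj,
      map_ofNat, hcc, hss, hcs, hsc] <;> ring

/-- explicit nearest free point for the R_y family and the
resulting upper bound `C(ρ_θ) ≤ cos θ + sin θ − 1`. -/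
theorem Ry_nearest_free_point (θ : ℝ) (h0 : 0 < θ) (h2 : θ < Real.pi / 2) :
    (Real.sin θ • proj pPlus + (1 - Real.sin θ) • proj e0) ∈ convexHull ℝ Stab2 ∧
    proj (psiRy θ) - (Real.sin θ • proj pPlus + (1 - Real.sin θ) • proj e0)
      = ((Real.cos θ + Real.sin θ - 1) / 2) • (proj e0 - proj e3) ∧
    (∑ α, |W2 (proj (psiRy θ)) α
        - W2 (Real.sin θ • proj pPlus + (1 - Real.sin θ) • proj e0) α|)
      = Real.cos θ + Real.sin θ - 1 ∧
    C2 (proj (psiRy θ)) ≤ Real.cos θ + Real.sin θ - 1 := by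
  have hs0 : 0 ≤ Real.sin θ := (Real.sin_pos_of_pos_of_lt_pi h0 (by linarith)).le
  have hs1 : 0 ≤ 1 - Real.sin θ := sub_nonneg.2 (Real.sin_le_one θ)
  have hc : 0 ≤ Real.cos θ := Real.cos_nonneg_of_mem_Icc ⟨by linarith, h2.le⟩
  have hk : 0 ≤ (Real.cos θ + Real.sin θ - 1) / 2 := by
    nlinarith [Real.sin_sq_add_cos_sq θ, mul_nonneg hs0 hc]
  have hdist : (∑ α, |W2 (proj (psiRy θ)) α
      - W2 (Real.sin θ • proj pPlus + (1 - Real.sin θ) • proj e0) α|)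
      = Real.cos θ + Real.sin θ - 1 := by
    simp only [← Pi.sub_apply, ← W2_sub, proj_psiRy_sub θ, W2_smul, Pi.smul_apply, smul_eq_mul,
      abs_mul, abs_of_nonneg hk, ← Finset.mul_sum, sum_abs_W2_proj_e0_sub_proj_e3]
    ring
  have hmem : W2 (Real.sin θ • proj pPlus + (1 - Real.sin θ) • proj e0) ∈ WFree2 := by
    rw [W2_add, W2_smul, W2_smul]
    refine convex_convexHull ℝ _ (subset_convexHull ℝ _ ?_) (subset_convexHull ℝ _ ?_)
      hs0 hs1 (add_sub_cancel _ _)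
    exacts [⟨_, proj_pPlus_mem_Stab2, rfl⟩, ⟨_, proj_e0_mem_Stab2, rfl⟩]
  refine ⟨convex_convexHull ℝ _ (subset_convexHull ℝ _ proj_pPlus_mem_Stab2)
    (subset_convexHull ℝ _ proj_e0_mem_Stab2) hs0 hs1 (add_sub_cancel _ _),
    proj_psiRy_sub θ, hdist, csInf_le ⟨0, ?_⟩ ⟨_, hmem, hdist.symm⟩⟩
  rintro _ ⟨f, -, rfl⟩
  exact Finset.sum_nonneg fun _ _ => abs_nonneg _
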